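/- One has F1'(s)·s / F1(s) ≤ 2 for every s ≥ δ, F1'(s)·s / F1(s) > 1 for every s > 0, and F1'(s)·s / F1(s) → 2 as s → +∞. -/

import Mathlib

open Real Filter

/-- The convex part `F₁` of the decomposition of `(1/2) s² log s²`. -/
noncomputable def F1 (δ : ℝ) : ℝ → ℝ := fun s =>
  if |s| < δ then -(1/2) * s^2 * Real.log (s^2)
  else -(1/2) * s^2 * (Real.log (δ^2) + 3) + 2*δ*|s| - δ^2/2

/-- The subcritical part `F₂` of the decomposition of `(1/2) s² log s²`. -/
noncomputable def F2 (δ : ℝ) : ℝ → ℝ := fun s =>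
  if |s| < δ then 0
  else (1/2) * s^2 * Real.log (s^2/δ^2) + 2*δ*|s| - (3/2)*s^2 - δ^2/2

/-- The derivative of `F1`. -/
noncomputable def F1' (δ : ℝ) : ℝ → ℝ := fun s =>
  if |s| < δ then -(Real.log (s^2) + 1) * s
  else -(Real.log (δ^2) + 3) * s + 2*δ*Real.sign s

/-- The derivative of `F2`. -/
noncomputable def F2' (δ : ℝ) : ℝ → ℝ := fun s =>
  if |s| ≤ δ then 0
  else s * Real.log (s^2/δ^2) + 2*δ*Real.sign s - 2*s

theorem log_sq_lt_neg_three {δ : ℝ} (hδ0 : 0 < δ) (hδ : δ < Real.exp (-(3/2))) :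
    Real.log (δ^2) < -3 := by
  have h : Real.log δ < -(3/2) := (Real.log_lt_iff_lt_exp hδ0).2 hδ
  rw [Real.log_pow]
  push_cast
  linarith

theorem F1_of_le {δ s : ℝ} (hδ0 : 0 < δ) (hs : δ ≤ s) :
    F1 δ s = -(Real.log (δ^2) + 3) * s^2 / 2 + 2 * δ * s - δ^2 / 2 := by
  have h : |s| = s := abs_of_pos (hδ0.trans_le hs)
  simp only [F1, h, if_neg hs.not_gt]
  ring

theorem F1'_of_le {δ s : ℝ} (hδ0 : 0 < δ) (hs : δ ≤ s) :
    F1' δ s = -(Real.log (δ^2) + 3) * s + 2 * δ := by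
  have h0 : 0 < s := hδ0.trans_le hs
  simp only [F1', abs_of_pos h0, if_neg hs.not_gt, Real.sign_of_pos h0, mul_one]

theorem F1_pos_of_le {δ s : ℝ} (hδ0 : 0 < δ) (hδ : δ < Real.exp (-(3/2))) (hs : δ ≤ s) :
    0 < F1 δ s := by
  rw [F1_of_le hδ0 hs]
  have hc : 0 < -(Real.log (δ^2) + 3) := by linarith [log_sq_lt_neg_three hδ0 hδ]
  have h0 : 0 < s := hδ0.trans_le hs
  have h1 : 0 < -(Real.log (δ^2) + 3) * s^2 := by positivity
  nlinarith [mul_le_mul_of_nonneg_left hs hδ0.le]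

/-- `F1' s · s / F1 s ≤ 2` for `s ≥ δ`, `F1' s · s / F1 s > 1` for `s > 0`, and
`F1' s · s / F1 s → 2` as `s → +∞`. -/
theorem F1_ratio_large (δ : ℝ) (hδ0 : 0 < δ) (hδ : δ < Real.exp (-(3/2))) :
    (∀ s : ℝ, δ ≤ s → F1' δ s * s / F1 δ s ≤ 2) ∧
    (∀ s : ℝ, 0 < s → 1 < F1' δ s * s / F1 δ s) ∧
    Filter.Tendsto (fun s : ℝ => F1' δ s * s / F1 δ s) Filter.atTop (nhds 2) := by
  have hL := log_sq_lt_neg_three hδ0 hδ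
  have hc : 0 < -(Real.log (δ^2) + 3) := by linarith
  refine ⟨fun s hs => ?_, fun s h0 => ?_, ?_⟩
  · rw [div_le_iff₀ (F1_pos_of_le hδ0 hδ hs), F1'_of_le hδ0 hs, F1_of_le hδ0 hs]
    nlinarith [mul_le_mul_of_nonneg_left hs hδ0.le]
  · rcases lt_or_ge s δ with hs | hs
    · have hlog : Real.log (s^2) < -3 :=
        (Real.log_lt_log (by positivity) (by gcongr)).trans hL
      have h2 : 0 < s^2 := by positivity
      simp only [F1, F1', abs_of_pos h0, if_pos hs]
      rw [one_lt_div (by nlinarith)]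
      nlinarith
    · rw [one_lt_div (F1_pos_of_le hδ0 hδ hs), F1'_of_le hδ0 hs, F1_of_le hδ0 hs]
      have h1 : 0 < -(Real.log (δ^2) + 3) * s^2 := by positivity
      nlinarith [pow_pos hδ0 2]
  · set c := -(Real.log (δ^2) + 3)
    have hinv : Tendsto (fun s : ℝ => s⁻¹) atTop (nhds 0) := tendsto_inv_atTop_zero
    have hnum : Tendsto (fun s : ℝ => c + 2 * δ * s⁻¹) atTop (nhds c) := by
      simpa using (hinv.const_mul (2 * δ)).const_add c
    have hden : Tendsto (fun s : ℝ => c / 2 + 2 * δ * s⁻¹ - δ^2 / 2 * s⁻¹ ^ 2)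
        atTop (nhds (c / 2)) := by
      simpa using ((hinv.const_mul (2 * δ)).const_add (c / 2)).sub
        ((hinv.pow 2).const_mul (δ^2 / 2))
    have hlim := hnum.div hden (by positivity)
    rw [show c / (c / 2) = 2 by field_simp] at hlim
    refine hlim.congr' ?_
    filter_upwards [eventually_ge_atTop δ] with s hs
    have h0 : s ≠ 0 := (hδ0.trans_le hs).ne'
    rw [F1'_of_le hδ0 hs, F1_of_le hδ0 hs, Pi.div_apply,
      ← mul_div_mul_right _ _ (pow_ne_zero 2 h0)]
    congr 1 <;> field_simp <;> ring
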